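/- arXiv:1708.04478 — 2 statements merged into one kernel-verified Lean document; each statement's English description precedes it below -/
import Mathlib

section
/- Let Γ be the free group on p ≥ 2 generators acting convex co-compactly by isometries on a CAT(-1) space, and suppose there are constants C_1, C_2 > 0 with C_1|x| ≤ d(o,xo) ≤ C_2|x| for all x ∈ Γ. Let 𝔠 be a non-trivial conjugacy class with minimal word length k, and suppose the averages (1/#Γ_n)Σ_{x∈Γ_n} d(o,xo)/n converge to λ. If F(x) = d(o,xo) satisfies F(x) = f^{|x|}(x) for a function f Lipschitz on the space Σ* of reduced words, then lim_{m→∞} (1/#𝔠_{k+2m}) Σ_{x∈𝔠_{k+2m}} d(o,xo)/(k+2m) = λ, and λ = ∫ f dμ_0 where μ_0 is the measure of maximal entropy on Σ. -/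
open Classical MeasureTheory Filter
open scoped Topology ENNReal

/-- Alphabet of `2p` symbols. -/
abbrev Symb (p : ℕ) := Fin p × Bool

/-- Alphabet together with the empty symbol `none`. -/
abbrev OSymb (p : ℕ) := Option (Symb p)

/-- A sequence represents a (finite or infinite) reduced word. -/
def RedSeq (p : ℕ) (x : ℕ → OSymb p) : Prop :=
  (∀ n a b, x n = some a → x (n + 1) = some b → b ≠ (a.1, !a.2)) ∧
  (∀ n, x n = none → x (n + 1) = none)

/-- The shift map on `Σ*`. -/
def sh (p : ℕ) (x : ℕ → OSymb p) : ℕ → OSymb p := fun n => x (n + 1)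

/-- The metric `d_θ`. -/
noncomputable def dtheta (p : ℕ) (θ : ℝ) (x y : ℕ → OSymb p) : ℝ :=
  if x = y then 0 else θ ^ sInf {n : ℕ | x n ≠ y n}

/-- The point of `Σ*` associated to a finite word. -/
def seqOf (p : ℕ) (L : List (Symb p)) : ℕ → OSymb p := fun n => L[n]?

/-- A list is a reduced word. -/
def ListRed (p : ℕ) (w : List (Symb p)) : Prop :=
  List.Chain' (fun a b : Symb p => b ≠ (a.1, !a.2)) w

/-- Birkhoff sum. -/
noncomputable def birk (p : ℕ) (f : (ℕ → OSymb p) → ℝ) (n : ℕ) (x : ℕ → OSymb p) : ℝ :=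
  ∑ j ∈ Finset.range n, f ((sh p)^[j] x)

/-- The space `Σ` of infinite reduced words. -/
abbrev Sig (p : ℕ) := {x : ℕ → Symb p // ∀ n, x (n + 1) ≠ ((x n).1, !(x n).2)}

noncomputable instance (p : ℕ) : MeasurableSpace (Sig p) := borel (Sig p)

/-- Cylinder sets. -/
def cyl (p : ℕ) (w : List (Symb p)) : Set (Sig p) :=
  {x | ∀ i, (h : i < w.length) → x.1 i = w.get ⟨i, h⟩}

/-- An infinite reduced word as a point of `Σ*`. -/
def embed (p : ℕ) (x : Sig p) : ℕ → OSymb p := fun n => some (x.1 n)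

namespace FreeGroupWords

open FreeGroup

/-- The reduced words of length `n + 1` with first letter `a`. -/
noncomputable def words (p : ℕ) : ℕ → Symb p → Finset (List (Symb p))
  | 0, a => {[a]}
  | n + 1, a => (Finset.univ.filter fun b => b ≠ (a.1, !a.2)).biUnion
      fun b => (words p n b).image (List.cons a)

/-- The reduced words of length `n + 1`. -/
noncomputable def sphere (p n : ℕ) : Finset (List (Symb p)) :=
  Finset.univ.biUnion (words p n)

/-- The average of a function over the reduced words of length `n + 1`. -/
noncomputable def sphereAvg (p : ℕ) (G : List (Symb p) → ℝ) (n : ℕ) : ℝ :=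
  (∑ a, ∑ L ∈ words p n a, G L) / (2 * p * (2 * p - 1 : ℝ) ^ n)

variable {p : ℕ}

lemma no_cancel_iff (a b : Symb p) : (a.1 = b.1 → a.2 = b.2) ↔ b ≠ (a.1, !a.2) := by
  rcases a with ⟨a, s⟩
  rcases b with ⟨b, t⟩
  cases s <;> cases t <;> simp [eq_comm]

lemma mem_words {n : ℕ} {a : Symb p} {L : List (Symb p)} :
    L ∈ words p n a ↔ IsReduced L ∧ L.length = n + 1 ∧ L.head? = some a := by
  induction n generalizing a L with
  | zero =>
    simp only [words, Finset.mem_singleton]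
    constructor
    · rintro rfl
      simp
    · rintro ⟨-, h1, h2⟩
      obtain ⟨b, rfl⟩ := List.length_eq_one_iff.1 h1
      simpa using h2
  | succ n ih =>
    simp only [words, Finset.mem_biUnion, Finset.mem_filter, Finset.mem_univ, true_and,
      Finset.mem_image]
    constructor
    · rintro ⟨b, hb, M, hM, rfl⟩
      obtain ⟨h1, h2, h3⟩ := ih.1 hM
      cases M with
      | nil => simp at h3
      | cons c M =>
        obtain rfl : c = b := by simpa using h3
        refine ⟨isReduced_cons_cons.2 ⟨(no_cancel_iff _ _).2 hb, h1⟩, by simpa using h2, by simp⟩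
    · rintro ⟨h1, h2, h3⟩
      match L, h1, h2, h3 with
      | [], _, h2, _ => simp at h2
      | [_], _, h2, _ => simp at h2
      | c :: b :: M, h1, h2, h3 =>
        obtain rfl : c = a := by simpa using h3
        rw [isReduced_cons_cons] at h1
        exact ⟨b, (no_cancel_iff _ _).1 h1.1, b :: M,
          ih.2 ⟨h1.2, by simpa using h2, by simp⟩, rfl⟩

lemma disjoint_words {n : ℕ} {a b : Symb p} (h : a ≠ b) :
    Disjoint (words p n a) (words p n b) := by
  rw [Finset.disjoint_left]
  intro L h1 h2
  have := (mem_words.1 h1).2.2.symm.trans (mem_words.1 h2).2.2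
  exact h (by simpa using this)

lemma mem_sphere {n : ℕ} {L : List (Symb p)} :
    L ∈ sphere p n ↔ IsReduced L ∧ L.length = n + 1 := by
  simp only [sphere, Finset.mem_biUnion, Finset.mem_univ, true_and, mem_words]
  constructor
  · rintro ⟨a, h1, h2, -⟩
    exact ⟨h1, h2⟩
  · rintro ⟨h1, h2⟩
    cases L with
    | nil => simp at h2
    | cons a L => exact ⟨a, h1, h2, rfl⟩

lemma sum_sphere (G : List (Symb p) → ℝ) (n : ℕ) :
    ∑ L ∈ sphere p n, G L = ∑ a, ∑ L ∈ words p n a, G L :=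
  Finset.sum_biUnion fun _ _ _ _ h => disjoint_words h

lemma sum_words_succ (G : List (Symb p) → ℝ) (n : ℕ) (a : Symb p) :
    ∑ L ∈ words p (n + 1) a, G L = ∑ b, ∑ L ∈ words p n b, G (a :: L)
      - ∑ L ∈ words p n (a.1, !a.2), G (a :: L) := by
  rw [words, Finset.sum_biUnion, Finset.filter_ne', ← Finset.sum_erase_eq_sub (Finset.mem_univ _)]
  · exact Finset.sum_congr rfl fun b _ => Finset.sum_image (by simp)
  · intro b _ c _ h
    exact Finset.disjoint_image (List.cons_injective) |>.2 (disjoint_words h)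

lemma sum_inv_letter (H : Symb p → ℝ) : ∑ a : Symb p, H (a.1, !a.2) = ∑ a, H a :=
  Equiv.sum_comp (Function.Involutive.toPerm (fun a : Symb p => (a.1, !a.2)) (by intro; simp)) H

lemma card_symb : (Fintype.card (Symb p) : ℝ) = 2 * p := by
  simp [Symb, mul_comm]

lemma card_words (n : ℕ) (a : Symb p) : ((words p n a).card : ℝ) = (2 * p - 1 : ℝ) ^ n := by
  induction n generalizing a with
  | zero => simp [words]
  | succ n ih =>
    have h (m : ℕ) (b : Symb p) : ((words p m b).card : ℝ) = ∑ L ∈ words p m b, 1 := by simp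
    rw [h, sum_words_succ]
    simp only [← h, ih, Finset.sum_const, Finset.card_univ, nsmul_eq_mul, card_symb]
    ring

lemma sum_words_tail (F : List (Symb p) → ℝ) (n : ℕ) :
    ∑ a, ∑ L ∈ words p (n + 1) a, F L.tail
      = (2 * p - 1) * ∑ a, ∑ L ∈ words p n a, F L := by
  simp only [sum_words_succ, List.tail_cons, Finset.sum_sub_distrib, Finset.sum_const,
    Finset.card_univ, nsmul_eq_mul, card_symb,
    sum_inv_letter fun a => ∑ L ∈ words p n a, F L]
  ring

lemma two_p_sub_one_pos (hp : 2 ≤ p) : (3 : ℝ) ≤ 2 * p - 1 := by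
  have : (2 : ℝ) ≤ p := by exact_mod_cast hp
  linarith

lemma sphereAvg_of_cons (hp : 2 ≤ p) (F φ : List (Symb p) → ℝ) (h0 : F [] = 0)
    (hF : ∀ a L, F (a :: L) = φ (a :: L) + F L) (n : ℕ) :
    sphereAvg p F n = ∑ i ∈ Finset.range (n + 1), sphereAvg p φ i := by
  induction n with
  | zero => simp [sphereAvg, words, hF, h0]
  | succ n ih =>
    have hq := two_p_sub_one_pos hp
    rw [Finset.sum_range_succ, ← ih, sphereAvg, sphereAvg, sphereAvg]
    have h : ∑ a, ∑ L ∈ words p (n + 1) a, F L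
        = ∑ a, ∑ L ∈ words p (n + 1) a, φ L + (2 * p - 1) * ∑ a, ∑ L ∈ words p n a, F L := by
      rw [← sum_words_tail, ← Finset.sum_add_distrib]
      refine Finset.sum_congr rfl fun a _ => ?_
      rw [← Finset.sum_add_distrib]
      refine Finset.sum_congr rfl fun L hL => ?_
      cases L with
      | nil => simp [mem_words] at hL
      | cons b L => exact hF b L
    have h1 : (2 * p - 1 : ℝ) ≠ 0 := by linarith
    have h2 : (p : ℝ) ≠ 0 := by linarith
    rw [h]
    field_simp
    ring

lemma abs_sum_words_sub_le (hp : 2 ≤ p) (F : List (Symb p) → ℝ) (B : ℝ)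
    (h1 : ∀ a b, |F [a] - F [b]| ≤ B)
    (hF : ∀ a L, IsReduced (a :: L) → |F (a :: L) - F L| ≤ B) (n : ℕ) (a b : Symb p) :
    |∑ L ∈ words p n a, F L - ∑ L ∈ words p n b, F L| ≤ 4 * B * (2 * p - 1) ^ n := by
  have hq := two_p_sub_one_pos hp
  have hB : 0 ≤ B := (abs_nonneg _).trans (h1 a a)
  induction n generalizing a b with
  | zero =>
    have := h1 a b
    simp only [words, Finset.sum_singleton, pow_zero]
    linarith
  | succ n ih =>
    have key (a : Symb p) : |∑ L ∈ words p (n + 1) a, F L - (∑ b, ∑ L ∈ words p n b, F L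
        - ∑ L ∈ words p n (a.1, !a.2), F L)| ≤ B * (2 * p - 1) ^ (n + 1) := by
      have := sum_words_succ (fun L => F L.tail) n a
      simp only [List.tail_cons] at this
      rw [← this, ← Finset.sum_sub_distrib, mul_comm, ← card_words (n + 1) a, ← nsmul_eq_mul]
      refine (Finset.abs_sum_le_sum_abs _ _).trans (Finset.sum_le_card_nsmul _ _ _ fun L hL => ?_)
      obtain ⟨h1, h2, -⟩ := mem_words.1 hL
      cases L with
      | nil => simp at h2
      | cons c L => exact hF c L h1
    have ha := abs_le.1 (key a)
    have hb := abs_le.1 (key b)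
    have hab := abs_le.1 (ih (a.1, !a.2) (b.1, !b.2))
    have hpow : 3 * (B * (2 * p - 1) ^ n) ≤ (B * (2 * p - 1) ^ (n + 1)) := by
      have := mul_le_mul_of_nonneg_left hq
        (mul_nonneg hB (pow_nonneg (by linarith : (0 : ℝ) ≤ 2 * p - 1) n))
      rw [pow_succ]
      linarith
    rw [abs_le]
    constructor <;> nlinarith [ha.1, ha.2, hb.1, hb.2, hab.1, hab.2]

lemma abs_sum_words_sub_sphereAvg_le (hp : 2 ≤ p) (F : List (Symb p) → ℝ) (B : ℝ)
    (h1 : ∀ a b, |F [a] - F [b]| ≤ B)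
    (hF : ∀ a L, IsReduced (a :: L) → |F (a :: L) - F L| ≤ B) (n : ℕ) (b : Symb p) :
    |∑ L ∈ words p n b, F L - (2 * p - 1) ^ n * sphereAvg p F n| ≤ 4 * B * (2 * p - 1) ^ n := by
  have hq := two_p_sub_one_pos hp
  have hp0 : (0 : ℝ) < 2 * p := by linarith
  have hqn : (2 * p - 1 : ℝ) ^ n ≠ 0 := by positivity
  have h : ∑ L ∈ words p n b, F L - (2 * p - 1) ^ n * sphereAvg p F n
      = (∑ a, (∑ L ∈ words p n b, F L - ∑ L ∈ words p n a, F L)) / (2 * p) := by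
    have hp1 : (p : ℝ) ≠ 0 := by linarith
    rw [Finset.sum_sub_distrib, Finset.sum_const, Finset.card_univ, nsmul_eq_mul, card_symb,
      sphereAvg]
    field_simp
  rw [h, abs_div, abs_of_pos hp0, div_le_iff₀ hp0]
  refine (Finset.abs_sum_le_sum_abs _ _).trans ((Finset.sum_le_card_nsmul _ _ _
    fun a _ => abs_sum_words_sub_le hp F B h1 hF n b a).trans_eq ?_)
  rw [Finset.card_univ, nsmul_eq_mul, card_symb, mul_comm]

lemma isReduced_left {L M : List (Symb p)} (h : IsReduced (L ++ M)) : IsReduced L :=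
  List.IsChain.left_of_append h

lemma isReduced_right {L M : List (Symb p)} (h : IsReduced (L ++ M)) : IsReduced M :=
  List.IsChain.right_of_append h

lemma toWord_mk_of_isReduced {L : List (Symb p)} (h : IsReduced L) : (mk L).toWord = L := by
  rw [toWord_mk, h.reduce_eq]

lemma norm_mk_of_isReduced {L : List (Symb p)} (h : IsReduced L) : (mk L).norm = L.length := by
  rw [FreeGroup.norm, toWord_mk_of_isReduced h]

lemma injOn_mk : Set.InjOn (mk : List (Symb p) → FreeGroup (Fin p)) {L | IsReduced L} := by
  intro L hL M hM h
  rw [← toWord_mk_of_isReduced hL, h, toWord_mk_of_isReduced hM]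

lemma isReduced_invRev {L : List (Symb p)} (h : IsReduced L) : IsReduced (invRev L) := by
  rw [isReduced_iff_reduce_eq, reduce_invRev, h.reduce_eq]

lemma setOf_norm_eq (n : ℕ) :
    {x : FreeGroup (Fin p) | x.norm = n + 1} = ((sphere p n).image mk : Finset _) := by
  ext x
  simp only [Set.mem_ofPred_eq, Finset.coe_image, Set.mem_image, Finset.mem_coe, mem_sphere]
  constructor
  · exact fun h => ⟨x.toWord, ⟨isReduced_toWord, h⟩, mk_toWord⟩
  · rintro ⟨L, ⟨h1, h2⟩, rfl⟩
    rw [norm_mk_of_isReduced h1, h2]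

lemma average_norm_eq (G : FreeGroup (Fin p) → ℝ) (n : ℕ) :
    (∑ᶠ x ∈ {x : FreeGroup (Fin p) | x.norm = n + 1}, G x)
      / Set.ncard {x : FreeGroup (Fin p) | x.norm = n + 1} = sphereAvg p (fun L => G (mk L)) n := by
  have hinj : Set.InjOn (mk : List (Symb p) → FreeGroup (Fin p)) (sphere p n) :=
    injOn_mk.mono fun L hL => (mem_sphere.1 hL).1
  rw [setOf_norm_eq, finsum_mem_coe_finset, Finset.sum_image hinj, Set.ncard_coe_finset,
    Finset.card_image_of_injOn hinj, sum_sphere, sphereAvg]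
  congr 1
  rw [sphere, Finset.card_biUnion fun _ _ _ _ h => disjoint_words h]
  push_cast
  simp only [card_words, Finset.sum_const, Finset.card_univ, nsmul_eq_mul, card_symb]

lemma dtheta_le {θ : ℝ} (h0 : 0 < θ) (h1 : θ < 1) {x y : ℕ → OSymb p} {n : ℕ}
    (h : ∀ i < n, x i = y i) : dtheta p θ x y ≤ θ ^ n := by
  rw [dtheta]
  split_ifs with hxy
  · positivity
  · refine pow_le_pow_of_le_one h0.le h1.le (le_csInf (Function.ne_iff.1 hxy) fun m hm => ?_)
    exact not_lt.1 fun hlt => hm (h m hlt)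

lemma redSeq_seqOf {L : List (Symb p)} (h : IsReduced L) : RedSeq p (seqOf p L) := by
  refine ⟨fun n a b ha hb => ?_, fun n hn => ?_⟩
  · obtain ⟨h1, rfl⟩ := List.getElem?_eq_some_iff.1 ha
    obtain ⟨h2, rfl⟩ := List.getElem?_eq_some_iff.1 hb
    exact (no_cancel_iff _ _).1 (List.isChain_iff_getElem.1 h n h2)
  · simp only [seqOf, List.getElem?_eq_none_iff] at hn ⊢
    omega

lemma redSeq_embed (x : Sig p) : RedSeq p (embed p x) := by
  refine ⟨fun n a b ha hb => ?_, fun n hn => by simp [embed] at hn⟩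
  simp only [embed, Option.some.injEq] at ha hb
  rw [← ha, ← hb]
  exact x.2 n

lemma birk_nil (f : (ℕ → OSymb p) → ℝ) : birk p f ([] : List (Symb p)).length (seqOf p []) = 0 := by
  simp [birk]

lemma birk_cons (f : (ℕ → OSymb p) → ℝ) (a : Symb p) (L : List (Symb p)) :
    birk p f (a :: L).length (seqOf p (a :: L))
      = f (seqOf p (a :: L)) + birk p f L.length (seqOf p L) := by
  have : sh p (seqOf p (a :: L)) = seqOf p L := by
    ext n
    simp [sh, seqOf]
  simp only [birk, List.length_cons, Finset.sum_range_succ', Function.iterate_succ_apply, this]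
  simp [add_comm]

section Lipschitz

variable {θ C : ℝ} {f : (ℕ → OSymb p) → ℝ}

lemma abs_sub_le_of_agree (h0 : 0 < θ) (h1 : θ < 1) (hC : 0 ≤ C)
    (hf : ∀ x y, RedSeq p x → RedSeq p y → |f x - f y| ≤ C * dtheta p θ x y)
    {x y : ℕ → OSymb p} (hx : RedSeq p x) (hy : RedSeq p y) {n : ℕ} (h : ∀ i < n, x i = y i) :
    |f x - f y| ≤ C * θ ^ n :=
  (hf x y hx hy).trans (mul_le_mul_of_nonneg_left (dtheta_le h0 h1 h) hC)

lemma abs_birk_append_sub_le (h0 : 0 < θ) (h1 : θ < 1) (hC : 0 ≤ C)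
    (hf : ∀ x y, RedSeq p x → RedSeq p y → |f x - f y| ≤ C * dtheta p θ x y)
    {L M : List (Symb p)} (h : IsReduced (L ++ M)) :
    |birk p f (L ++ M).length (seqOf p (L ++ M)) - birk p f L.length (seqOf p L)
      - birk p f M.length (seqOf p M)| ≤ C / (1 - θ) := by
  have hθ : 0 < 1 - θ := by linarith
  have hD : 0 ≤ C / (1 - θ) := by positivity
  suffices |birk p f (L ++ M).length (seqOf p (L ++ M)) - birk p f L.length (seqOf p L)
      - birk p f M.length (seqOf p M)| ≤ C / (1 - θ) * (1 - θ ^ L.length) from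
    this.trans (mul_le_of_le_one_right hD (by linarith [pow_pos h0 L.length]))
  induction L with
  | nil => simpa using birk_nil f
  | cons a L ih =>
    have ih := abs_le.1 (ih (isReduced_right (L := [a]) h))
    have hfa : |f (seqOf p (a :: L ++ M)) - f (seqOf p (a :: L))| ≤ C * θ ^ (a :: L).length :=
      abs_sub_le_of_agree h0 h1 hC hf (redSeq_seqOf h)
        (redSeq_seqOf (isReduced_left h)) fun i hi => List.getElem?_append_left hi
    have hfa := abs_le.1 hfa
    have hCD : C = C / (1 - θ) * (1 - θ) := by field_simp
    have hle : C * θ ^ (a :: L).length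
        ≤ C / (1 - θ) * (1 - θ ^ (a :: L).length) - C / (1 - θ) * (1 - θ ^ L.length) := by
      calc C * θ ^ (a :: L).length ≤ C * θ ^ L.length :=
            mul_le_mul_of_nonneg_left
              (pow_le_pow_of_le_one h0.le h1.le (by simp)) hC
        _ = C / (1 - θ) * (1 - θ) * θ ^ L.length := by rw [← hCD]
        _ = _ := by rw [List.length_cons, pow_succ]; ring
    rw [birk_cons, List.cons_append, birk_cons, abs_le]
    rw [List.cons_append] at hfa
    constructor <;> linarith [ih.1, ih.2, hfa.1, hfa.2]

instance : BorelSpace (Sig p) := ⟨rfl⟩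

lemma isOpen_cyl (w : List (Symb p)) : IsOpen (cyl p w) := by
  have : cyl p w = ⋂ i : Fin w.length, {x : Sig p | x.1 i = w.get i} := by
    ext x
    simp [cyl, Fin.forall_iff]
  rw [this]
  refine isOpen_iInter_of_finite fun i => ?_
  have hcont : Continuous fun x : Sig p => x.1 i :=
    (continuous_apply (i : ℕ)).comp continuous_subtype_val
  exact (isOpen_discrete {w.get i}).preimage hcont

/-- The first `n` letters of an infinite reduced word. -/
def pre (n : ℕ) (x : Sig p) : List (Symb p) := List.ofFn fun i : Fin n => x.1 i

lemma isReduced_pre (n : ℕ) (x : Sig p) : IsReduced (pre n x) := by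
  refine List.isChain_iff_getElem.2 fun i hi => ?_
  simp only [pre, List.getElem_ofFn]
  exact (no_cancel_iff _ _).2 (x.2 i)

lemma mem_cyl_iff {w : List (Symb p)} {x : Sig p} : x ∈ cyl p w ↔ pre w.length x = w := by
  simp only [cyl, pre, Set.mem_ofPred_eq]
  constructor
  · intro h
    refine List.ext_getElem (by simp) fun i h1 h2 => ?_
    simpa using h i h2
  · intro h i hi
    have := List.getElem_of_eq h (i := i) (by simpa using hi)
    simpa using this

lemma embed_eq_of_mem_cyl {w : List (Symb p)} {x : Sig p} (h : x ∈ cyl p w) :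
    ∀ i < w.length, embed p x i = seqOf p w i := by
  intro i hi
  simp [embed, seqOf, hi, h i hi]

lemma continuous_comp_embed (h0 : 0 < θ) (h1 : θ < 1) (hC : 0 ≤ C)
    (hf : ∀ x y, RedSeq p x → RedSeq p y → |f x - f y| ≤ C * dtheta p θ x y) :
    Continuous fun x => f (embed p x) := by
  rw [continuous_iff_continuousAt]
  intro x
  rw [ContinuousAt, Metric.tendsto_nhds]
  intro ε hε
  have hlim : Tendsto (fun n : ℕ => C * θ ^ n) atTop (𝓝 (C * 0)) :=
    (tendsto_pow_atTop_nhds_zero_of_lt_one h0.le h1).const_mul C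
  rw [mul_zero] at hlim
  obtain ⟨n, hn⟩ := (hlim.eventually_lt_const hε).exists
  have hlen : (pre n x).length = n := by simp [pre]
  have hx : x ∈ cyl p (pre n x) := by rw [mem_cyl_iff, hlen]
  filter_upwards [(isOpen_cyl (pre n x)).mem_nhds hx] with y hy
  rw [Real.dist_eq]
  refine (abs_sub_le_of_agree h0 h1 hC hf (redSeq_embed y) (redSeq_embed x)
    (n := n) fun i hi => ?_).trans_lt hn
  rw [embed_eq_of_mem_cyl hy i (by rwa [hlen]), embed_eq_of_mem_cyl hx i (by rwa [hlen])]

lemma integrable_comp_embed (h0 : 0 < θ) (h1 : θ < 1) (hC : 0 ≤ C)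
    (hf : ∀ x y, RedSeq p x → RedSeq p y → |f x - f y| ≤ C * dtheta p θ x y)
    (μ : Measure (Sig p)) [IsFiniteMeasure μ] : Integrable (fun x => f (embed p x)) μ := by
  refine Integrable.of_bound
    (continuous_comp_embed h0 h1 hC hf).measurable.aestronglyMeasurable
    (C + |f (seqOf p [])|) (Eventually.of_forall fun x => ?_)
  have := abs_sub_le_of_agree h0 h1 hC hf (redSeq_embed x) (redSeq_seqOf IsReduced.nil) (n := 0)
    (by simp)
  rw [pow_zero, mul_one] at this
  rw [Real.norm_eq_abs]
  linarith [abs_sub_abs_le_abs_sub (f (embed p x)) (f (seqOf p []))]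

lemma abs_sphereAvg_sub_integral_le (hp : 2 ≤ p) (h0 : 0 < θ) (h1 : θ < 1) (hC : 0 ≤ C)
    (hf : ∀ x y, RedSeq p x → RedSeq p y → |f x - f y| ≤ C * dtheta p θ x y)
    (μ : Measure (Sig p)) [IsProbabilityMeasure μ]
    (hμ : ∀ w : List (Symb p), ListRed p w → 1 ≤ w.length →
      μ (cyl p w) = ((2 * p : ℕ) : ℝ≥0∞)⁻¹ * (((2 * p - 1 : ℕ) : ℝ≥0∞)⁻¹) ^ (w.length - 1))
    (n : ℕ) :
    |sphereAvg p (fun L => f (seqOf p L)) n - ∫ x, f (embed p x) ∂μ| ≤ C * θ ^ (n + 1) := by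
  have hfint := integrable_comp_embed h0 h1 hC hf μ
  have hμr (L) (hL : L ∈ sphere p n) : μ.real (cyl p L) = (2 * p * (2 * p - 1 : ℝ) ^ n)⁻¹ := by
    obtain ⟨hL1, hL2⟩ := mem_sphere.1 hL
    have hred : ListRed p L :=
      List.IsChain.imp (fun a b h => (no_cancel_iff a b).1 h) hL1
    rw [measureReal_def, hμ L hred (by omega), hL2]
    have : ((2 * p - 1 : ℕ) : ℝ) = 2 * p - 1 := by
      rw [Nat.cast_sub (by omega)]
      push_cast
      ring
    simp only [ENNReal.toReal_mul, ENNReal.toReal_pow, ENNReal.toReal_inv, ENNReal.toReal_natCast,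
      ENNReal.toReal_ofNat,
      this, add_tsub_cancel_right, inv_pow, mul_inv, Nat.cast_mul, Nat.cast_ofNat]
  have hcover : ⋃ L ∈ sphere p n, cyl p L = Set.univ := by
    refine Set.eq_univ_of_forall fun x => ?_
    have hlen : (pre (n + 1) x).length = n + 1 := by simp [pre]
    simp only [Set.mem_iUnion]
    exact ⟨pre (n + 1) x, mem_sphere.2 ⟨isReduced_pre _ _, hlen⟩, by rw [mem_cyl_iff, hlen]⟩
  have hdisj : Set.Pairwise (sphere p n : Set (List (Symb p)))
      (Function.onFun Disjoint (cyl p)) := by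
    intro L hL M hM hne
    refine Set.disjoint_left.2 fun x hx hy => hne ?_
    rw [← mem_cyl_iff.1 hx, ← mem_cyl_iff.1 hy, (mem_sphere.1 hL).2, (mem_sphere.1 hM).2]
  have hsplit (g : Sig p → ℝ) (hg : Integrable g μ) :
      ∫ x, g x ∂μ = ∑ L ∈ sphere p n, ∫ x in cyl p L, g x ∂μ := by
    rw [← setIntegral_univ, ← hcover]
    exact integral_biUnion_finset _ (fun L _ => (isOpen_cyl L).measurableSet) hdisj
      fun _ _ => hg.integrableOn
  have hone : ∑ L ∈ sphere p n, μ.real (cyl p L) = 1 := by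
    have := hsplit (fun _ => 1) (integrable_const 1)
    simpa using this.symm
  have havg : sphereAvg p (fun L => f (seqOf p L)) n
      = ∑ L ∈ sphere p n, ∫ _ in cyl p L, f (seqOf p L) ∂μ := by
    rw [sphereAvg, ← sum_sphere, div_eq_mul_inv, Finset.sum_mul]
    refine Finset.sum_congr rfl fun L hL => ?_
    rw [setIntegral_const, hμr L hL, smul_eq_mul, mul_comm]
  rw [havg, hsplit _ hfint, ← Finset.sum_sub_distrib]
  calc _ ≤ ∑ L ∈ sphere p n, C * θ ^ (n + 1) * μ.real (cyl p L) := by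
        refine (Finset.abs_sum_le_sum_abs _ _).trans (Finset.sum_le_sum fun L hL => ?_)
        rw [← integral_sub (integrable_const _) hfint.integrableOn, ← Real.norm_eq_abs]
        refine norm_setIntegral_le_of_norm_le_const (measure_lt_top _ _) fun x hx => ?_
        obtain ⟨hL1, hL2⟩ := mem_sphere.1 hL
        rw [Real.norm_eq_abs, abs_sub_comm]
        exact abs_sub_le_of_agree h0 h1 hC hf (redSeq_embed x) (redSeq_seqOf hL1)
          fun i hi => embed_eq_of_mem_cyl hx i (by rwa [hL2])
    _ = C * θ ^ (n + 1) := by rw [← Finset.mul_sum, hone, mul_one]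

lemma tendsto_sphereAvg_birk (hp : 2 ≤ p) (h0 : 0 < θ) (h1 : θ < 1) (hC : 0 ≤ C)
    (hf : ∀ x y, RedSeq p x → RedSeq p y → |f x - f y| ≤ C * dtheta p θ x y)
    (μ : Measure (Sig p)) [IsProbabilityMeasure μ]
    (hμ : ∀ w : List (Symb p), ListRed p w → 1 ≤ w.length →
      μ (cyl p w) = ((2 * p : ℕ) : ℝ≥0∞)⁻¹ * (((2 * p - 1 : ℕ) : ℝ≥0∞)⁻¹) ^ (w.length - 1)) :
    Tendsto (fun n : ℕ => sphereAvg p (fun L => birk p f L.length (seqOf p L)) n / (n + 1))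
      atTop (𝓝 (∫ x, f (embed p x) ∂μ)) := by
  have hu : Tendsto (sphereAvg p fun L => f (seqOf p L)) atTop (𝓝 (∫ x, f (embed p x) ∂μ)) := by
    rw [tendsto_iff_norm_sub_tendsto_zero]
    have hlim : Tendsto (fun n : ℕ => C * θ ^ (n + 1)) atTop (𝓝 (C * 0)) :=
      ((tendsto_pow_atTop_nhds_zero_of_lt_one h0.le h1).comp (tendsto_add_atTop_nat 1)).const_mul C
    rw [mul_zero] at hlim
    exact squeeze_zero (fun _ => norm_nonneg _)
      (abs_sphereAvg_sub_integral_le hp h0 h1 hC hf μ hμ) hlim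
  refine (hu.cesaro.comp (tendsto_add_atTop_nat 1)).congr fun n => ?_
  rw [sphereAvg_of_cons hp _ (fun L => f (seqOf p L)) (birk_nil f) (birk_cons f)]
  simp [div_eq_inv_mul]

end Lipschitz

lemma norm_pow_of_isCyclicallyReduced {L : List (Symb p)} (h : IsCyclicallyReduced L) (n : ℕ) :
    (mk L ^ n).norm = n * L.length := by
  rw [pow_mk, norm_mk_of_isReduced (h.flatten_replicate n).isReduced]
  simp

lemma norm_pow_le (x : FreeGroup (Fin p)) (n : ℕ) : (x ^ n).norm ≤ n * x.norm := by
  induction n with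
  | zero => simp
  | succ n ih =>
    rw [pow_succ, add_mul, one_mul]
    exact (FreeGroup.norm_mul_le _ _).trans (Nat.add_le_add_right ih _)

lemma length_le_norm_of_isConj {L : List (Symb p)} (h : IsCyclicallyReduced L)
    {y : FreeGroup (Fin p)} (hy : IsConj y (mk L)) : L.length ≤ y.norm := by
  obtain ⟨g, hg⟩ := isConj_iff.1 hy
  by_contra! hlt
  have hle : (2 * g.norm + 1) * L.length ≤ g.norm + (2 * g.norm + 1) * y.norm + g.norm := by
    rw [← norm_pow_of_isCyclicallyReduced h, ← hg, conj_pow]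
    refine (FreeGroup.norm_mul_le _ _).trans ?_
    rw [norm_inv_eq]
    exact Nat.add_le_add_right ((FreeGroup.norm_mul_le _ _).trans
      (Nat.add_le_add_left (norm_pow_le _ _) _)) _
  nlinarith

/-- The pairs consisting of a shortest word `w` representing a conjugate of `c` and a letter which
may follow `w` and whose inverse may precede `w` in a reduced word. -/
noncomputable def cores (c : FreeGroup (Fin p)) (k : ℕ) : Finset (List (Symb p) × Symb p) :=
  (((sphere p (k - 1)).filter fun w => IsConj c (mk w)) ×ˢ Finset.univ).filter
    fun j => IsReduced (j.1 ++ [j.2]) ∧ IsReduced ([(j.2.1, !j.2.2)] ++ j.1)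

/-- The data `(w, b, h)` describing the reduced words `h⁻¹ w h` conjugate to `c`, where `h` has
length `n + 1` and first letter `b`. -/
noncomputable def conjData (c : FreeGroup (Fin p)) (k n : ℕ) :
    Finset (Σ _ : List (Symb p) × Symb p, List (Symb p)) :=
  (cores c k).sigma fun j => words p n j.2

/-- The word `h⁻¹ w h`. -/
def conjWord (e : Σ _ : List (Symb p) × Symb p, List (Symb p)) : List (Symb p) :=
  invRev e.2 ++ (e.1.1 ++ e.2)

lemma mem_cores {c : FreeGroup (Fin p)} {k : ℕ} (hk : 1 ≤ k) {j : List (Symb p) × Symb p} :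
    j ∈ cores c k ↔ (IsReduced j.1 ∧ j.1.length = k ∧ IsConj c (mk j.1)) ∧
      IsReduced (j.1 ++ [j.2]) ∧ IsReduced ([(j.2.1, !j.2.2)] ++ j.1) := by
  simp [cores, mem_sphere, Nat.sub_add_cancel hk, and_assoc]

lemma isReduced_conjWord {w h : List (Symb p)} {b : Symb p} (hw : w ≠ [])
    (h1 : IsReduced (w ++ [b])) (h2 : IsReduced ([(b.1, !b.2)] ++ w)) (hh : IsReduced (b :: h)) :
    IsReduced (invRev (b :: h) ++ (w ++ (b :: h))) := by
  have hwh : IsReduced (w ++ (b :: h)) := by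
    simpa using IsReduced.append_overlap (L₃ := h) h1 hh (by simp)
  have hinv : invRev (b :: h) = invRev h ++ [(b.1, !b.2)] := by simp [invRev]
  have hhw : IsReduced (invRev (b :: h) ++ w) := by
    have := isReduced_invRev hh
    rw [hinv] at this ⊢
    exact this.append_overlap h2 (by simp)
  simpa using hhw.append_overlap hwh hw

lemma isReduced_conjWord_of_mem {c : FreeGroup (Fin p)} {k n : ℕ} (hk : 1 ≤ k)
    {e : Σ _ : List (Symb p) × Symb p, List (Symb p)} (he : e ∈ conjData c k n) :
    IsReduced (conjWord e) := by
  obtain ⟨⟨w, b⟩, h⟩ := e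
  simp only [conjData, Finset.mem_sigma, mem_cores hk, mem_words] at he
  obtain ⟨⟨⟨-, hw, -⟩, h1, h2⟩, h3, -, h4⟩ := he
  cases h with
  | nil => simp at h4
  | cons a h =>
    obtain rfl : a = b := by simpa using h4
    exact isReduced_conjWord (by rintro rfl; simp at hw; omega) h1 h2 h3

lemma injOn_conjWord (c : FreeGroup (Fin p)) (k n : ℕ) :
    Set.InjOn conjWord (conjData c k n : Set (Σ _ : List (Symb p) × Symb p, List (Symb p))) := by
  rintro ⟨⟨w, b⟩, h⟩ he ⟨⟨w', b'⟩, h'⟩ he' heq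
  simp only [conjData, Finset.mem_coe, Finset.mem_sigma, mem_words] at he he'
  obtain ⟨-, -, hl, hb⟩ := he
  obtain ⟨-, -, hl', hb'⟩ := he'
  obtain ⟨h1, h2⟩ := List.append_inj heq (by simp [hl, hl'])
  obtain rfl := invRev_injective h1
  obtain rfl := List.append_cancel_right h2
  have := hb.symm.trans hb'
  simp_all

lemma setOf_isConj_eq {c : FreeGroup (Fin p)} {k : ℕ} (hk1 : 1 ≤ k)
    (hk : IsLeast {n : ℕ | ∃ x : FreeGroup (Fin p), IsConj c x ∧ x.norm = n} k) (n : ℕ) :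
    {x : FreeGroup (Fin p) | IsConj c x ∧ x.norm = k + 2 * (n + 1)}
      = ((conjData c k n).image (fun e => mk (conjWord e)) : Finset _) := by
  have hconj (w h : List (Symb p)) : IsConj (mk w) (mk (invRev h ++ (w ++ h))) := by
    rw [isConj_iff]
    refine ⟨(mk h)⁻¹, ?_⟩
    simp only [← mul_mk, inv_mk, invRev_invRev, mul_assoc]
  ext x
  simp only [Set.mem_ofPred_eq, Finset.coe_image, Set.mem_image, Finset.mem_coe]
  constructor
  · rintro ⟨hx, hn⟩
    set h := invRev (reduceCyclically.conjugator x.toWord)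
    set w := reduceCyclically x.toWord with hw
    have hxw : invRev h ++ (w ++ h) = x.toWord := by
      rw [invRev_invRev, ← List.append_assoc]
      exact reduceCyclically.conj_conjugator_reduceCyclically _
    have hwred : IsCyclicallyReduced w := reduceCyclically.isCyclicallyReduced isReduced_toWord
    have hcw : IsConj c (mk w) := by
      refine hx.trans (IsConj.symm ?_)
      have := hconj w h
      rwa [hxw, mk_toWord] at this
    have hwk : w.length = k := by
      obtain ⟨y, hy, hyk⟩ := hk.1
      refine le_antisymm (hyk ▸ length_le_norm_of_isConj hwred (hy.symm.trans hcw))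
        (hk.2 ⟨mk w, hcw, norm_mk_of_isReduced hwred.isReduced⟩)
    have hlen := congrArg List.length hxw
    rw [List.length_append, List.length_append, invRev_length, ← FreeGroup.norm, hn, hwk] at hlen
    have hred : IsReduced (invRev h ++ (w ++ h)) := hxw ▸ isReduced_toWord
    clear_value h w
    cases h with
    | nil => simp at hlen
    | cons b h =>
      have hinv : invRev (b :: h) = invRev h ++ [(b.1, !b.2)] := by simp [invRev]
      refine ⟨⟨(w, b), b :: h⟩, ?_, by rw [conjWord, hxw, mk_toWord]⟩
      simp only [conjData, Finset.mem_sigma, mem_cores hk1, mem_words]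
      refine ⟨⟨⟨hwred.isReduced, hwk, hcw⟩, ?_, ?_⟩,
        isReduced_right (isReduced_right hred), ?_, rfl⟩
      · exact isReduced_left (M := h) (by simpa using isReduced_right hred)
      · rw [← List.append_assoc, hinv, List.append_assoc (invRev h)] at hred
        exact isReduced_right (isReduced_left (by simpa using hred) :
          IsReduced (invRev h ++ ([(b.1, !b.2)] ++ w)))
      omega
  · rintro ⟨e, he, rfl⟩
    rw [norm_mk_of_isReduced (isReduced_conjWord_of_mem hk1 he)]
    simp only [conjData, Finset.mem_sigma, mem_cores hk1, mem_words] at he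
    obtain ⟨⟨⟨-, hw, hcw⟩, -⟩, -, hl, -⟩ := he
    refine ⟨hcw.trans (hconj _ _), ?_⟩
    simp only [conjWord, List.length_append, invRev_length, hw, hl]
    omega

lemma cores_nonempty (hp : 2 ≤ p) {c : FreeGroup (Fin p)} {k : ℕ} (hk1 : 1 ≤ k)
    (hk : IsLeast {n : ℕ | ∃ x : FreeGroup (Fin p), IsConj c x ∧ x.norm = n} k) :
    (cores c k).Nonempty := by
  obtain ⟨x, hx, hxk⟩ := hk.1
  have hne : x.toWord ≠ [] := by
    intro h
    rw [FreeGroup.norm, h] at hxk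
    simp at hxk
    omega
  obtain ⟨b, hb⟩ : ∃ b : Symb p, b ∉ ({((x.toWord.getLast hne).1, !(x.toWord.getLast hne).2),
      x.toWord.head hne} : Finset (Symb p)) := by
    by_contra! hall
    have := (Finset.card_le_card fun b _ => hall b : (Finset.univ : Finset (Symb p)).card ≤ _).trans
      Finset.card_le_two
    simp [Symb] at this
    omega
  simp only [Finset.mem_insert, Finset.mem_singleton, not_or] at hb
  have hred : IsReduced x.toWord := isReduced_toWord
  refine ⟨(x.toWord, b), (mem_cores hk1).2 ⟨⟨hred, hxk, by rwa [mk_toWord]⟩, ?_, ?_⟩⟩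
  · refine List.isChain_append.2 ⟨hred, IsReduced.singleton, fun a ha d hd => ?_⟩
    obtain rfl : b = d := by simpa using hd
    rw [List.getLast?_eq_some_getLast hne] at ha
    obtain rfl : x.toWord.getLast hne = a := by simpa using ha
    exact (no_cancel_iff _ _).2 hb.1
  · refine List.isChain_append.2 ⟨IsReduced.singleton, hred, fun a ha d hd => ?_⟩
    obtain rfl : (b.1, !b.2) = a := by simpa using ha
    rw [List.head?_eq_some_head hne] at hd
    obtain rfl : x.toWord.head hne = d := by simpa using hd
    exact (no_cancel_iff _ _).2 (by simpa using Ne.symm hb.2)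

lemma abs_average_isConj_sub_le (hp : 2 ≤ p) (G : FreeGroup (Fin p) → ℝ) (B : ℝ)
    (hinv : ∀ x, G x⁻¹ = G x)
    (happ : ∀ L M, IsReduced (L ++ M) → |G (mk (L ++ M)) - G (mk L) - G (mk M)| ≤ B)
    (hG : ∀ x, |G x| ≤ B * x.norm)
    {c : FreeGroup (Fin p)} {k : ℕ} (hk1 : 1 ≤ k)
    (hk : IsLeast {n : ℕ | ∃ x : FreeGroup (Fin p), IsConj c x ∧ x.norm = n} k) (n : ℕ) :
    |(∑ᶠ x ∈ {x : FreeGroup (Fin p) | IsConj c x ∧ x.norm = k + 2 * (n + 1)}, G x)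
      / Set.ncard {x : FreeGroup (Fin p) | IsConj c x ∧ x.norm = k + 2 * (n + 1)}
      - 2 * sphereAvg p (fun L => G (mk L)) n| ≤ (k + 18) * B := by
  have hq := two_p_sub_one_pos hp
  have hinj : Set.InjOn (fun e => mk (conjWord e)) (conjData c k n : Set
      (Σ _ : List (Symb p) × Symb p, List (Symb p))) := fun e he e' he' h =>
    injOn_conjWord c k n he he'
      (injOn_mk (isReduced_conjWord_of_mem hk1 he) (isReduced_conjWord_of_mem hk1 he') h)
  have hsingle (a : Symb p) : |G (mk [a])| ≤ B := by
    simpa [norm_mk_of_isReduced IsReduced.singleton] using hG (mk [a])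
  have hwords (b : Symb p) : |∑ L ∈ words p n b, G (mk L)
      - (2 * p - 1) ^ n * sphereAvg p (fun L => G (mk L)) n| ≤ 8 * B * (2 * p - 1) ^ n := by
    have := abs_sum_words_sub_sphereAvg_le hp (fun L => G (mk L)) (2 * B) (fun a b => ?_)
      (fun a L h => ?_) n b
    · linarith
    · linarith [abs_sub (G (mk [a])) (G (mk [b])), hsingle a, hsingle b]
    · have h1 := abs_le.1 (happ [a] L h)
      have h2 := abs_le.1 (hsingle a)
      rw [List.singleton_append] at h1
      rw [abs_le]
      constructor <;> linarith [h1.1, h1.2, h2.1, h2.2]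
  have hword (e) (he : e ∈ conjData c k n) :
      |G (mk (conjWord e)) - 2 * G (mk e.2)| ≤ (k + 2) * B := by
    have hred := isReduced_conjWord_of_mem hk1 he
    rw [conjWord] at hred ⊢
    have h1 := abs_le.1 (happ _ _ hred)
    have h2 := abs_le.1 (happ e.1.1 e.2 (isReduced_right hred))
    have h3 := hG (mk e.1.1)
    simp only [conjData, Finset.mem_sigma, mem_cores hk1] at he
    rw [norm_mk_of_isReduced he.1.1.1, he.1.1.2.1] at h3
    have h3 := abs_le.1 h3
    rw [← inv_mk, hinv] at h1
    rw [abs_le]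
    constructor <;> linarith [h1.1, h1.2, h2.1, h2.2, h3.1, h3.2]
  have hcard : ((conjData c k n).card : ℝ) = (cores c k).card * (2 * p - 1) ^ n := by
    simp [conjData, card_words]
  have hpos : (0 : ℝ) < (conjData c k n).card := by
    have : (0 : ℝ) < (cores c k).card := by exact_mod_cast (cores_nonempty hp hk1 hk).card_pos
    rw [hcard]
    positivity
  rw [setOf_isConj_eq hk1 hk, finsum_mem_coe_finset, Finset.sum_image hinj, Set.ncard_coe_finset,
    Finset.card_image_of_injOn hinj, div_sub' hpos.ne', abs_div, abs_of_pos hpos,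
    div_le_iff₀ hpos]
  have hA : |∑ e ∈ conjData c k n, G (mk (conjWord e)) - ∑ e ∈ conjData c k n, 2 * G (mk e.2)|
      ≤ (conjData c k n).card * ((k + 2) * B) := by
    rw [← Finset.sum_sub_distrib, ← nsmul_eq_mul]
    exact (Finset.abs_sum_le_sum_abs _ _).trans (Finset.sum_le_card_nsmul _ _ _ hword)
  have hB : |∑ e ∈ conjData c k n, 2 * G (mk e.2)
      - (conjData c k n).card * (2 * sphereAvg p (fun L => G (mk L)) n)|
      ≤ (conjData c k n).card * (16 * B) := by
    have : ∑ e ∈ conjData c k n, 2 * G (mk e.2)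
        - (conjData c k n).card * (2 * sphereAvg p (fun L => G (mk L)) n)
        = ∑ j ∈ cores c k, 2 * (∑ L ∈ words p n j.2, G (mk L)
          - (2 * p - 1) ^ n * sphereAvg p (fun L => G (mk L)) n) := by
      rw [conjData, Finset.sum_sigma, ← conjData, hcard]
      simp only [mul_sub, Finset.sum_sub_distrib, Finset.mul_sum, Finset.sum_const, nsmul_eq_mul]
      ring
    rw [this, hcard, mul_assoc, ← nsmul_eq_mul]
    refine (Finset.abs_sum_le_sum_abs _ _).trans (Finset.sum_le_card_nsmul _ _ _ fun j _ => ?_)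
    rw [abs_mul, abs_two]
    linarith [hwords j.2]
  have hA := abs_le.1 hA
  have hB := abs_le.1 hB
  rw [abs_le]
  constructor <;> linarith [hA.1, hA.2, hB.1, hB.2]

lemma tendsto_average_isConj (hp : 2 ≤ p) (G : FreeGroup (Fin p) → ℝ) (B : ℝ)
    (hinv : ∀ x, G x⁻¹ = G x)
    (happ : ∀ L M, IsReduced (L ++ M) → |G (mk (L ++ M)) - G (mk L) - G (mk M)| ≤ B)
    (hG : ∀ x, |G x| ≤ B * x.norm)
    {c : FreeGroup (Fin p)} {k : ℕ} (hk1 : 1 ≤ k)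
    (hk : IsLeast {n : ℕ | ∃ x : FreeGroup (Fin p), IsConj c x ∧ x.norm = n} k) {l : ℝ}
    (hl : Tendsto (fun n : ℕ => sphereAvg p (fun L => G (mk L)) n / (n + 1)) atTop (𝓝 l)) :
    Tendsto (fun m : ℕ =>
        (∑ᶠ x ∈ {x : FreeGroup (Fin p) | IsConj c x ∧ x.norm = k + 2 * m}, G x)
          / ((Set.ncard {x : FreeGroup (Fin p) | IsConj c x ∧ x.norm = k + 2 * m})
            * (k + 2 * m))) atTop (𝓝 l) := by
  rw [← tendsto_add_atTop_iff_nat 1]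
  have hden : Tendsto (fun n : ℕ => (k : ℝ) + 2 * ((n + 1 : ℕ) : ℝ)) atTop atTop := by
    refine tendsto_atTop_mono (fun n => ?_) tendsto_natCast_atTop_atTop
    push_cast
    have : (0 : ℝ) ≤ k := k.cast_nonneg
    have : (0 : ℝ) ≤ n := n.cast_nonneg
    linarith
  have hpos (n : ℕ) : (0 : ℝ) < (k : ℝ) + 2 * ((n + 1 : ℕ) : ℝ) := by positivity
  have hratio : Tendsto (fun n : ℕ => 1 - k / ((k : ℝ) + 2 * ((n + 1 : ℕ) : ℝ)))
      atTop (𝓝 (1 - 0)) := (hden.const_div_atTop _).const_sub 1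
  have hmain := hl.mul hratio
  rw [sub_zero, mul_one] at hmain
  refine tendsto_of_tendsto_of_dist hmain ?_
  refine squeeze_zero (fun _ => dist_nonneg) (fun n => ?_) (hden.const_div_atTop ((k + 18) * B))
  have hn : (n + 1 : ℝ) ≠ 0 := by positivity
  have h : sphereAvg p (fun L => G (mk L)) n / (n + 1) * (1 - k / ((k : ℝ) + 2 * ((n + 1 : ℕ) : ℝ)))
      = 2 * sphereAvg p (fun L => G (mk L)) n / ((k : ℝ) + 2 * ((n + 1 : ℕ) : ℝ)) := by
    have := (hpos n).ne'
    push_cast at this ⊢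
    field_simp
    ring
  rw [dist_comm, Real.dist_eq, h, ← div_div, ← sub_div, abs_div, abs_of_pos (hpos n)]
  exact div_le_div_of_nonneg_right (abs_average_isConj_sub_le hp G B hinv happ hG hk1 hk n)
    (hpos n).le

end FreeGroupWords

/-- Equidistribution over a conjugacy class: for a free group of rank `p ≥ 2` acting
convex co-compactly by isometries on a CAT(-1) space (so that `C₁|x| ≤ d(o,xo) ≤ C₂|x|`),
if the sphere averages of `d(o,xo)/n` converge to `λ` and the displacement
`d(o,xo)` is the Birkhoff sum of a Lipschitz function `f` on the space of reduced words,
then the averages of `d(o,xo)/(k+2m)` over the elements of word length `k+2m` in a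
non-trivial conjugacy class also converge to `λ`, and `λ = ∫ f dμ₀` where `μ₀` is the
measure of maximal entropy (the Parry measure). -/
theorem stmt17 (p : ℕ) (hp : 2 ≤ p) (X : Type*) [MetricSpace X]
    [MulAction (FreeGroup (Fin p)) X]
    (hiso : ∀ g : FreeGroup (Fin p), Isometry (fun x : X => g • x)) (o : X)
    (C1 C2 : ℝ) (hC1 : 0 < C1) (hC2 : 0 < C2)
    (hcomp : ∀ x : FreeGroup (Fin p),
      C1 * FreeGroup.norm x ≤ dist o (x • o) ∧ dist o (x • o) ≤ C2 * FreeGroup.norm x)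
    (lam : ℝ)
    (hlam : Tendsto (fun n : ℕ =>
        (∑ᶠ x ∈ {x : FreeGroup (Fin p) | FreeGroup.norm x = n}, dist o (x • o))
          / ((Set.ncard {x : FreeGroup (Fin p) | FreeGroup.norm x = n}) * n))
      atTop (𝓝 lam))
    (θ : ℝ) (hθ0 : 0 < θ) (hθ1 : θ < 1) (C : ℝ) (f : (ℕ → OSymb p) → ℝ)
    (hf : ∀ x y, RedSeq p x → RedSeq p y → |f x - f y| ≤ C * dtheta p θ x y)
    (hF : ∀ x : FreeGroup (Fin p),
      dist o (x • o) = birk p f (FreeGroup.norm x) (seqOf p x.toWord))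
    (μ0 : Measure (Sig p)) (hprob : IsProbabilityMeasure μ0)
    (hParry : ∀ w : List (Symb p), ListRed p w → 1 ≤ w.length →
      μ0 (cyl p w) = ((2 * p : ℕ) : ℝ≥0∞)⁻¹ * (((2 * p - 1 : ℕ) : ℝ≥0∞)⁻¹) ^ (w.length - 1))
    (c : FreeGroup (Fin p)) (hc : c ≠ 1) (k : ℕ)
    (hk : IsLeast {n : ℕ | ∃ x : FreeGroup (Fin p), IsConj c x ∧ FreeGroup.norm x = n} k) :
    Tendsto (fun m : ℕ =>
        (∑ᶠ x ∈ {x : FreeGroup (Fin p) | IsConj c x ∧ FreeGroup.norm x = k + 2 * m},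
            dist o (x • o))
          / ((Set.ncard {x : FreeGroup (Fin p) | IsConj c x ∧ FreeGroup.norm x = k + 2 * m})
              * (k + 2 * m)))
      atTop (𝓝 lam) ∧
    lam = ∫ x, f (embed p x) ∂μ0 := by
  have hsymb : Nonempty (Symb p) := ⟨(⟨0, by omega⟩, true)⟩
  have hC : 0 ≤ C := by
    obtain ⟨a⟩ := hsymb
    have hne : seqOf p [] ≠ seqOf p [a] := fun h => by simpa [seqOf] using congrFun h 0
    have h := (abs_nonneg _).trans (hf _ _ (FreeGroupWords.redSeq_seqOf FreeGroup.IsReduced.nil)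
      (FreeGroupWords.redSeq_seqOf (FreeGroup.IsReduced.singleton (a := a))))
    rw [dtheta, if_neg hne] at h
    exact nonneg_of_mul_nonneg_left h (by positivity)
  have hword (L : List (Symb p)) (hL : FreeGroup.IsReduced L) :
      dist o (FreeGroup.mk L • o) = birk p f L.length (seqOf p L) := by
    rw [hF, FreeGroupWords.norm_mk_of_isReduced hL, FreeGroupWords.toWord_mk_of_isReduced hL]
  have hlim : Tendsto (fun n : ℕ => FreeGroupWords.sphereAvg p
      (fun L => dist o (FreeGroup.mk L • o)) n / (n + 1)) atTop (𝓝 lam) := by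
    refine ((tendsto_add_atTop_iff_nat 1).2 hlam).congr fun n => ?_
    rw [← div_div, FreeGroupWords.average_norm_eq fun x => dist o (x • o)]
    push_cast
    rfl
  refine ⟨?_, ?_⟩
  · have hk1 : 1 ≤ k := by
      obtain ⟨x, hx, hxk⟩ := hk.1
      rw [Nat.one_le_iff_ne_zero]
      rintro rfl
      rw [FreeGroup.norm_eq_zero.1 hxk, isConj_one_left] at hx
      exact hc hx
    refine FreeGroupWords.tendsto_average_isConj hp (fun x => dist o (x • o))
      (max C2 (C / (1 - θ))) (fun x => ?_) (fun L M h => ?_) (fun x => ?_) hk1 hk hlim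
    · have := (hiso x).dist_eq o (x⁻¹ • o)
      rw [smul_inv_smul] at this
      rw [← this, dist_comm]
    · rw [hword _ h, hword L (FreeGroupWords.isReduced_left h),
        hword M (FreeGroupWords.isReduced_right h)]
      exact (FreeGroupWords.abs_birk_append_sub_le hθ0 hθ1 hC hf h).trans (le_max_right _ _)
    · rw [abs_of_nonneg dist_nonneg]
      exact (hcomp x).2.trans (mul_le_mul_of_nonneg_right (le_max_left _ _) (Nat.cast_nonneg _))
  · refine tendsto_nhds_unique hlim
      ((FreeGroupWords.tendsto_sphereAvg_birk hp hθ0 hθ1 hC hf μ0 hParry).congr fun n => ?_)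
    rw [FreeGroupWords.sphereAvg, FreeGroupWords.sphereAvg]
    congr 2
    refine Finset.sum_congr rfl fun a _ => Finset.sum_congr rfl fun L hL => ?_
    exact (hword L (FreeGroupWords.mem_words.1 hL).1).symm
end

section
/- Let f : Σ* → ℝ be Lipschitz on the space of finite and infinite reduced words on 2p symbols (p ≥ 2), and define F : Γ → ℝ by F(x) = f^{|x|}(x). Suppose F(x) = F(x^{-1}) for all x ∈ Γ and ∫ f dμ_0 = 0. Let 𝔠 be a non-trivial conjugacy class with minimal length k, and let φ_m(t) = (1/#𝔠_{k+2m}) Σ_{x∈𝔠_{k+2m}} exp(itF(x)/√(k+2m)). Then for every t ∈ ℝ, φ_m(t) differs from (1/#𝔠_{k+2m}) Σ_{g∈𝔠_k} e^{τ f^k(g)/2} Σ_{w∈Γ_m(g)} e^{τ f^m(w)} (with τ = 2it/√(k+2m)) by a quantity tending to 0 as m → ∞. -/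
open Classical MeasureTheory Filter
open scoped Topology ENNReal

/-- `F(x) = f^{|x|}(x)` on the free group, via the reduced word of `x`. -/
noncomputable def Ff (p : ℕ) (f : (ℕ → OSymb p) → ℝ) (x : FreeGroup (Fin p)) : ℝ :=
  birk p f (FreeGroup.norm x) (seqOf p x.toWord)

/-- The set `Γ_m(g)` of reduced words of length `m` whose first letter is neither the
first letter of `g` nor the inverse of the last letter of `g`. -/
def GammaM (p : ℕ) (g : FreeGroup (Fin p)) (m : ℕ) : Set (FreeGroup (Fin p)) :=
  {w | FreeGroup.norm w = m ∧ ∀ a ∈ w.toWord.head?,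
    (∀ b ∈ g.toWord.head?, a ≠ b) ∧ (∀ b ∈ g.toWord.getLast?, a ≠ (b.1, !b.2))}

namespace FreeGroup

theorem mem_getLast?_invRev {α : Type*} {L : List (α × Bool)} {a : α × Bool} :
    a ∈ (invRev L).getLast? ↔ (a.1, !a.2) ∈ L.head? := by
  cases L with
  | nil => simp
  | cons b L =>
    rw [invRev_cons, List.getLast?_append]
    obtain ⟨a1, a2⟩ := a
    obtain ⟨b1, b2⟩ := b
    cases a2 <;> cases b2 <;> simp [invRev]

variable {α : Type*} [DecidableEq α]

theorem norm_pow_le (x : FreeGroup α) (n : ℕ) : norm (x ^ n) ≤ n * norm x := by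
  induction n with
  | zero => simp
  | succ n ih =>
    rw [pow_succ]
    have := norm_mul_le (x ^ n) x
    linarith

theorem IsCyclicallyReduced.norm_mk_pow {L : List (α × Bool)} (h : IsCyclicallyReduced L) (n : ℕ) :
    norm (mk L ^ n) = n * L.length := by
  rw [norm, toWord_pow, toWord_mk, h.isReduced.reduce_eq,
    (h.flatten_replicate n).isReduced.reduce_eq]
  simp

/-- A cyclically reduced word is no longer than any conjugate of the element it represents. -/
theorem IsCyclicallyReduced.length_le_norm_of_isConj {L : List (α × Bool)}
    (h : IsCyclicallyReduced L) {y : FreeGroup α} (hy : IsConj y (mk L)) :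
    L.length ≤ norm y := by
  obtain ⟨u, hu⟩ := isConj_iff.1 hy
  by_contra! hlt
  have hpow : ∀ n : ℕ, n * L.length ≤ n * norm y + 2 * norm u := by
    intro n
    rw [← h.norm_mk_pow, ← hu, conj_pow]
    have h1 := norm_mul_le (u * y ^ n) u⁻¹
    have h2 := norm_mul_le u (y ^ n)
    have h3 := norm_pow_le y n
    rw [norm_inv_eq] at h1
    linarith
  have := hpow (2 * norm u + 1)
  nlinarith

theorem isConj_mk_reduceCyclically (x : FreeGroup α) :
    IsConj x (mk (reduceCyclically x.toWord)) := by
  have h := congr_arg mk (reduceCyclically.conj_conjugator_reduceCyclically x.toWord)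
  rw [mk_toWord, ← mul_mk, ← mul_mk, ← inv_mk] at h
  exact (isConj_iff.2 ⟨_, h⟩).symm

/-- An element of minimal length in its conjugacy class is cyclically reduced. -/
theorem isCyclicallyReduced_toWord_of_minimal {x : FreeGroup α}
    (h : ∀ y, IsConj x y → norm x ≤ norm y) : IsCyclicallyReduced x.toWord := by
  have h1 := (h _ (isConj_mk_reduceCyclically x)).trans norm_mk_le
  have h2 := reduceCyclically.conj_conjugator_reduceCyclically x.toWord
  have h3 := congr_arg List.length h2
  simp only [List.length_append, invRev_length] at h3
  have h4 : reduceCyclically.conjugator x.toWord = [] := by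
    rw [← List.length_eq_zero_iff]
    unfold norm at h1
    omega
  have h5 := reduceCyclically.isCyclicallyReduced (isReduced_toWord (x := x))
  simp only [h4, List.nil_append, invRev_empty, List.append_nil] at h2
  rwa [h2] at h5

end FreeGroup

section Words

variable {p : ℕ}

theorem isReduced_conj_iff {g w : List (Symb p)} (hg : g ≠ []) :
    FreeGroup.IsReduced (FreeGroup.invRev w ++ g ++ w) ↔
      FreeGroup.IsReduced (FreeGroup.invRev w) ∧ FreeGroup.IsReduced g ∧ FreeGroup.IsReduced w ∧
        ∀ a ∈ w.head?, (∀ b ∈ g.head?, a ≠ b) ∧ (∀ b ∈ g.getLast?, a ≠ (b.1, !b.2)) := by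
  have hlast : (FreeGroup.invRev w ++ g).getLast? = g.getLast? := by
    rw [List.getLast?_append, Option.or_of_isSome (by simpa using hg)]
  simp only [FreeGroup.IsReduced, List.isChain_append, hlast]
  constructor
  · rintro ⟨⟨h1, h2, h3⟩, h4, h5⟩
    refine ⟨h1, h2, h4, fun a ha => ⟨fun b hb hab => ?_, fun b hb hab => ?_⟩⟩
    · have := h3 (a.1, !a.2) (FreeGroup.mem_getLast?_invRev.2 (by simpa using ha)) b hb
      subst hab
      simp at this
    · have := h5 b hb a ha
      subst hab
      simp at this
  · rintro ⟨h1, h2, h4, h⟩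
    refine ⟨⟨h1, h2, fun a ha b hb hab => ?_⟩, h4, fun b hb a ha hab => ?_⟩
    · have := (h _ (FreeGroup.mem_getLast?_invRev.1 ha)).1 b hb
      obtain ⟨a1, a2⟩ := a
      obtain ⟨b1, b2⟩ := b
      cases a2 <;> cases b2 <;> simp_all
    · have := (h a ha).2 b hb
      obtain ⟨a1, a2⟩ := a
      obtain ⟨b1, b2⟩ := b
      cases a2 <;> cases b2 <;> simp_all

theorem toWord_conj_of_mem_GammaM {g w : FreeGroup (Fin p)} {m : ℕ} (hg1 : g ≠ 1)
    (hw : w ∈ GammaM p g m) :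
    (w⁻¹ * g * w).toWord = FreeGroup.invRev w.toWord ++ g.toWord ++ w.toWord := by
  have hred : FreeGroup.IsReduced (FreeGroup.invRev w.toWord ++ g.toWord ++ w.toWord) := by
    rw [isReduced_conj_iff (by simpa using hg1), ← FreeGroup.toWord_inv]
    exact ⟨FreeGroup.isReduced_toWord, FreeGroup.isReduced_toWord, FreeGroup.isReduced_toWord,
      hw.2⟩
  rw [← hred.reduce_eq, ← FreeGroup.toWord_mk, ← FreeGroup.mul_mk, ← FreeGroup.mul_mk,
    ← FreeGroup.inv_mk]
  simp only [FreeGroup.mk_toWord]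

/-- Every conjugate `x` of `c` of length `k + 2m`, where `k` is the minimal length in the class
of `c`, is of the form `w⁻¹ g w` with `g` of length `k` and `w ∈ Γ_m(g)`. -/
theorem exists_eq_conj {c x : FreeGroup (Fin p)} (hc : c ≠ 1) {k m : ℕ}
    (hk : IsLeast {n : ℕ | ∃ x : FreeGroup (Fin p), IsConj c x ∧ FreeGroup.norm x = n} k)
    (hx : IsConj c x) (hxn : FreeGroup.norm x = k + 2 * m) :
    ∃ g w, (IsConj c g ∧ FreeGroup.norm g = k) ∧ w ∈ GammaM p g m ∧ w⁻¹ * g * w = x := by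
  set R := FreeGroup.reduceCyclically x.toWord
  set D := FreeGroup.reduceCyclically.conjugator x.toWord
  have hL : D ++ R ++ FreeGroup.invRev D = x.toWord :=
    FreeGroup.reduceCyclically.conj_conjugator_reduceCyclically x.toWord
  have hRc : FreeGroup.IsCyclicallyReduced R :=
    FreeGroup.reduceCyclically.isCyclicallyReduced FreeGroup.isReduced_toWord
  have hcR : IsConj c (FreeGroup.mk R) := hx.trans (FreeGroup.isConj_mk_reduceCyclically x)
  have hRw : (FreeGroup.mk R).toWord = R := by
    rw [FreeGroup.toWord_mk, hRc.isReduced.reduce_eq]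
  have hRlen : R.length = k := by
    apply le_antisymm
    · obtain ⟨y, hy, hyk⟩ := hk.1
      exact hyk ▸ hRc.length_le_norm_of_isConj (hy.symm.trans hcR)
    · exact (hk.2 ⟨_, hcR, rfl⟩).trans FreeGroup.norm_mk_le
  have hRne : R ≠ [] := by
    intro h
    rw [h, ← FreeGroup.one_eq_mk, isConj_one_left] at hcR
    exact hc hcR
  have hDlen : D.length = m := by
    have := congr_arg List.length hL
    simp only [List.length_append, FreeGroup.invRev_length] at this
    unfold FreeGroup.norm at hxn
    omega
  have hred : FreeGroup.IsReduced
      (FreeGroup.invRev (FreeGroup.invRev D) ++ R ++ FreeGroup.invRev D) := by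
    rw [FreeGroup.invRev_invRev, hL]
    exact FreeGroup.isReduced_toWord
  obtain ⟨-, -, h3, h4⟩ := (isReduced_conj_iff hRne).1 hred
  have hWw : (FreeGroup.mk (FreeGroup.invRev D)).toWord = FreeGroup.invRev D := by
    rw [FreeGroup.toWord_mk, h3.reduce_eq]
  refine ⟨FreeGroup.mk R, FreeGroup.mk (FreeGroup.invRev D), ⟨hcR, ?_⟩, ⟨?_, ?_⟩, ?_⟩
  · rw [FreeGroup.norm, hRw, hRlen]
  · rw [FreeGroup.norm, hWw, FreeGroup.invRev_length, hDlen]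
  · rw [hWw, hRw]
    exact h4
  · rw [FreeGroup.inv_mk, FreeGroup.invRev_invRev, FreeGroup.mul_mk, FreeGroup.mul_mk, hL,
      FreeGroup.mk_toWord]

theorem finite_norm_eq (n : ℕ) : {x : FreeGroup (Fin p) | FreeGroup.norm x = n}.Finite :=
  (List.finite_length_eq (Symb p) n).preimage FreeGroup.toWord_injective.injOn

end Words

section Birkhoff

variable {p : ℕ}

theorem sh_iterate (j : ℕ) (x : ℕ → OSymb p) : (sh p)^[j] x = fun n => x (n + j) := by
  induction j generalizing x with
  | zero => rfl
  | succ j ih =>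
    rw [Function.iterate_succ_apply, ih]
    funext n
    rw [sh, add_assoc]

theorem RedSeq.sh_iterate {x : ℕ → OSymb p} (hx : RedSeq p x) (j : ℕ) :
    RedSeq p ((sh p)^[j] x) := by
  rw [_root_.sh_iterate]
  refine ⟨fun n a b h1 h2 => hx.1 (n + j) a b h1 ?_, fun n h => ?_⟩
  · rw [← h2, add_right_comm]
  · have := hx.2 (n + j) h
    rwa [add_right_comm] at this

theorem redSeq_seqOf {L : List (Symb p)} (hL : FreeGroup.IsReduced L) : RedSeq p (seqOf p L) := by
  refine ⟨fun n a b h1 h2 hab => ?_, fun n h => ?_⟩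
  · obtain ⟨hn, rfl⟩ := List.getElem?_eq_some_iff.1 h1
    obtain ⟨hn', rfl⟩ := List.getElem?_eq_some_iff.1 h2
    have := List.isChain_iff_getElem.1 hL n hn'
    rw [hab] at this
    simp at this
  · rw [seqOf, List.getElem?_eq_none_iff] at h ⊢
    omega

theorem sh_iterate_seqOf_append (A B : List (Symb p)) :
    (sh p)^[A.length] (seqOf p (A ++ B)) = seqOf p B := by
  rw [sh_iterate]
  funext n
  simp [seqOf, List.getElem?_append_right]

theorem birk_add (f : (ℕ → OSymb p) → ℝ) (a b : ℕ) (x : ℕ → OSymb p) :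
    birk p f (a + b) x = birk p f a x + birk p f b ((sh p)^[a] x) := by
  simp only [birk, Finset.sum_range_add, ← Function.iterate_add_apply]
  simp only [add_comm a]

theorem dtheta_le_pow {θ : ℝ} (hθ0 : 0 < θ) (hθ1 : θ < 1) {x y : ℕ → OSymb p} {n : ℕ}
    (h : ∀ i < n, x i = y i) : dtheta p θ x y ≤ θ ^ n := by
  rw [dtheta]
  split_ifs with hxy
  · positivity
  · refine pow_le_pow_of_le_one hθ0.le hθ1.le (le_csInf (Function.ne_iff.1 hxy) fun i hi => ?_)
    by_contra! hlt
    exact hi (h i hlt)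

theorem abs_birk_sub_le {θ C : ℝ} (hθ0 : 0 < θ) (hθ1 : θ < 1) {f : (ℕ → OSymb p) → ℝ}
    (hf : ∀ x y, RedSeq p x → RedSeq p y → |f x - f y| ≤ C * dtheta p θ x y)
    {x y : ℕ → OSymb p} (hx : RedSeq p x) (hy : RedSeq p y) {n : ℕ} (h : ∀ i < n, x i = y i) :
    |birk p f n x - birk p f n y| ≤ |C| / (1 - θ) := by
  have hd : ∀ x y, 0 ≤ dtheta p θ x y := fun x y => by
    rw [dtheta]
    split_ifs <;> positivity
  have hterm : ∀ j ∈ Finset.range n,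
      |f ((sh p)^[j] x) - f ((sh p)^[j] y)| ≤ |C| * θ ^ (n - 1 - j) := by
    intro j hj
    rw [Finset.mem_range] at hj
    calc _ ≤ C * dtheta p θ ((sh p)^[j] x) ((sh p)^[j] y) :=
          hf _ _ (hx.sh_iterate j) (hy.sh_iterate j)
      _ ≤ |C| * dtheta p θ ((sh p)^[j] x) ((sh p)^[j] y) := by
          gcongr
          · exact hd _ _
          · exact le_abs_self C
      _ ≤ |C| * θ ^ (n - 1 - j) := by
          gcongr
          refine dtheta_le_pow hθ0 hθ1 fun i hi => ?_
          rw [sh_iterate, sh_iterate]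
          exact h _ (by omega)
  rw [birk, birk, ← Finset.sum_sub_distrib]
  calc _ ≤ ∑ j ∈ Finset.range n, |C| * θ ^ (n - 1 - j) :=
        (Finset.abs_sum_le_sum_abs _ _).trans (Finset.sum_le_sum hterm)
    _ = |C| * ∑ j ∈ Finset.range n, θ ^ j := by
        rw [Finset.sum_range_reflect (fun j => |C| * θ ^ j), Finset.mul_sum]
    _ ≤ |C| * (1 - θ)⁻¹ := by
        gcongr
        rw [← tsum_geometric_of_lt_one hθ0.le hθ1]
        exact (summable_geometric_of_lt_one hθ0.le hθ1).sum_le_tsum _ fun j _ => by positivity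
    _ = |C| / (1 - θ) := by rw [div_eq_mul_inv]

theorem seqOf_append_apply (A B : List (Symb p)) {i : ℕ} (hi : i < A.length) :
    seqOf p (A ++ B) i = seqOf p A i := by
  simp [seqOf, List.getElem?_append_left hi]

/-- The value of `F` at `w⁻¹ g w` is `f^k(g) + 2 f^m(w)` up to a bounded error. -/
theorem abs_Ff_conj_sub_le {θ C : ℝ} (hθ0 : 0 < θ) (hθ1 : θ < 1) {f : (ℕ → OSymb p) → ℝ}
    (hf : ∀ x y, RedSeq p x → RedSeq p y → |f x - f y| ≤ C * dtheta p θ x y)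
    (hsymm : ∀ x : FreeGroup (Fin p), Ff p f x = Ff p f x⁻¹)
    {g w : FreeGroup (Fin p)} {m : ℕ} (hg1 : g ≠ 1) (hw : w ∈ GammaM p g m) :
    |Ff p f (w⁻¹ * g * w) - (birk p f (FreeGroup.norm g) (seqOf p g.toWord)
      + 2 * birk p f m (seqOf p w.toWord))| ≤ 2 * (|C| / (1 - θ)) := by
  have hword := toWord_conj_of_mem_GammaM hg1 hw
  have hwn : w.toWord.length = m := hw.1
  have hred := FreeGroup.isReduced_toWord (x := w⁻¹ * g * w)
  have hinv : birk p f m (seqOf p (FreeGroup.invRev w.toWord)) = birk p f m (seqOf p w.toWord) := by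
    have := hsymm w
    rw [Ff, Ff, FreeGroup.norm_inv_eq, FreeGroup.toWord_inv, hw.1] at this
    exact this.symm
  have hnorm : FreeGroup.norm (w⁻¹ * g * w) = m + (FreeGroup.norm g + m) := by
    rw [FreeGroup.norm, hword]
    simp only [List.length_append, FreeGroup.invRev_length, hwn, FreeGroup.norm]
    ring
  rw [hword, List.append_assoc] at hred
  have hsplit : Ff p f (w⁻¹ * g * w) =
      birk p f m (seqOf p (FreeGroup.invRev w.toWord ++ (g.toWord ++ w.toWord)))
      + (birk p f (FreeGroup.norm g) (seqOf p (g.toWord ++ w.toWord))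
        + birk p f m (seqOf p w.toWord)) := by
    have h1 := sh_iterate_seqOf_append (FreeGroup.invRev w.toWord) (g.toWord ++ w.toWord)
    rw [FreeGroup.invRev_length, hwn] at h1
    have h2 := sh_iterate_seqOf_append g.toWord w.toWord
    rw [Ff, hnorm, hword, List.append_assoc, birk_add, birk_add, h1, FreeGroup.norm, h2]
  have e1 := abs_birk_sub_le hθ0 hθ1 hf (redSeq_seqOf hred)
    (redSeq_seqOf (FreeGroup.toWord_inv w ▸ FreeGroup.isReduced_toWord)) (n := m)
    fun i hi => seqOf_append_apply (FreeGroup.invRev w.toWord) (g.toWord ++ w.toWord)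
      (by rwa [FreeGroup.invRev_length, hwn])
  have e2 := abs_birk_sub_le hθ0 hθ1 hf
    (redSeq_seqOf (hred.infix (List.suffix_append _ _).isInfix))
    (redSeq_seqOf FreeGroup.isReduced_toWord) (n := FreeGroup.norm g)
    fun i hi => seqOf_append_apply g.toWord w.toWord hi
  rw [hinv] at e1
  rw [hsplit]
  rw [abs_le] at *
  constructor <;> linarith [e1.1, e1.2, e2.1, e2.2]

end Birkhoff

theorem norm_exp_I_mul_sub_le (a b : ℝ) :
    ‖Complex.exp (Complex.I * a) - Complex.exp (Complex.I * b)‖ ≤ |a - b| := by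
  have h : Complex.exp (Complex.I * a) - Complex.exp (Complex.I * b) =
      Complex.exp (Complex.I * b) * (Complex.exp (Complex.I * (a - b : ℝ)) - 1) := by
    rw [mul_sub, ← Complex.exp_add]
    push_cast
    ring_nf
  rw [h, norm_mul, mul_comm Complex.I (b : ℂ), Complex.norm_exp_ofReal_mul_I, one_mul]
  exact Real.norm_exp_I_mul_ofReal_sub_one_le

/-- Two sums of `#s` terms which are termwise `ε`-close have `ε`-close averages. -/
theorem norm_sum_div_card_sub_le {ι : Type*} (s : Finset ι) (u v : ι → ℂ) {ε : ℝ} (hε : 0 ≤ ε)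
    (h : ∀ i ∈ s, ‖u i - v i‖ ≤ ε) :
    ‖(∑ i ∈ s, u i) / (s.card : ℂ) - (∑ i ∈ s, v i) / (s.card : ℂ)‖ ≤ ε := by
  rw [← sub_div, ← Finset.sum_sub_distrib, norm_div, Complex.norm_natCast]
  refine div_le_of_le_mul₀ (by positivity) hε ?_
  refine (norm_sum_le_of_le s h).trans ?_
  rw [Finset.sum_const, nsmul_eq_mul, mul_comm]

/-- The characteristic function
`φ_m(t) = (1/#𝔠_{k+2m}) Σ_{x∈𝔠_{k+2m}} exp(itF(x)/√(k+2m))` differs from the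
transfer-operator expression
`(1/#𝔠_{k+2m}) Σ_{g∈𝔠_k} e^{τ f^k(g)/2} Σ_{w∈Γ_m(g)} e^{τ f^m(w)}`
(with `τ = 2it/√(k+2m)`) by a quantity tending to `0` as `m → ∞`, provided
`F(x) = f^{|x|}(x)` for a Lipschitz `f`, `F(x) = F(x⁻¹)` and `∫ f dμ₀ = 0`. -/
theorem stmt18 (p : ℕ) (hp : 2 ≤ p) (θ : ℝ) (hθ0 : 0 < θ) (hθ1 : θ < 1)
    (C : ℝ) (f : (ℕ → OSymb p) → ℝ)
    (hf : ∀ x y, RedSeq p x → RedSeq p y → |f x - f y| ≤ C * dtheta p θ x y)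
    (hsymm : ∀ x : FreeGroup (Fin p), Ff p f x = Ff p f x⁻¹)
    (μ0 : Measure (Sig p)) (hprob : IsProbabilityMeasure μ0)
    (hParry : ∀ w : List (Symb p), ListRed p w → 1 ≤ w.length →
      μ0 (cyl p w) = ((2 * p : ℕ) : ℝ≥0∞)⁻¹ * (((2 * p - 1 : ℕ) : ℝ≥0∞)⁻¹) ^ (w.length - 1))
    (hmean : ∫ x, f (embed p x) ∂μ0 = 0)
    (c : FreeGroup (Fin p)) (hc : c ≠ 1) (k : ℕ)
    (hk : IsLeast {n : ℕ | ∃ x : FreeGroup (Fin p), IsConj c x ∧ FreeGroup.norm x = n} k)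
    (t : ℝ) :
    Tendsto (fun m : ℕ =>
        (∑ᶠ x ∈ {x : FreeGroup (Fin p) | IsConj c x ∧ FreeGroup.norm x = k + 2 * m},
            Complex.exp (Complex.I * t * (Ff p f x) / Real.sqrt (k + 2 * m)))
          / (Set.ncard {x : FreeGroup (Fin p) | IsConj c x ∧ FreeGroup.norm x = k + 2 * m} : ℂ)
        - (∑ᶠ g ∈ {x : FreeGroup (Fin p) | IsConj c x ∧ FreeGroup.norm x = k},
            Complex.exp ((2 * Complex.I * t / Real.sqrt (k + 2 * m))
                * birk p f k (seqOf p g.toWord) / 2)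
              * ∑ᶠ w ∈ GammaM p g m,
                  Complex.exp ((2 * Complex.I * t / Real.sqrt (k + 2 * m))
                    * birk p f m (seqOf p w.toWord)))
          / (Set.ncard {x : FreeGroup (Fin p) | IsConj c x ∧ FreeGroup.norm x = k + 2 * m} : ℂ))
      atTop (𝓝 0) := by
  set A : Set (FreeGroup (Fin p)) := {x | IsConj c x ∧ FreeGroup.norm x = k}
  have hAfin : A.Finite := (finite_norm_eq k).subset fun x hx => hx.2
  have hA1 : ∀ g ∈ A, g ≠ 1 := by
    rintro g ⟨hg, -⟩ rfl
    exact hc (isConj_one_left.1 hg)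
  have hBfin : ∀ g m, (GammaM p g m).Finite := fun g m =>
    (finite_norm_eq m).subset fun x hx => hx.1
  set K : ℝ := |t| * (2 * (|C| / (1 - θ)))
  have hK0 : 0 ≤ K := by
    have : 0 < 1 - θ := by linarith
    positivity
  have hlim : Tendsto (fun m : ℕ => K / Real.sqrt (k + 2 * m)) atTop (𝓝 0) := by
    refine Tendsto.const_div_atTop (Real.tendsto_sqrt_atTop.comp ?_) K
    refine tendsto_atTop_add_const_left _ _ ?_
    exact tendsto_natCast_atTop_atTop.const_mul_atTop two_pos
  refine squeeze_zero_norm (fun m => ?_) hlim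
  set X : Set (FreeGroup (Fin p)) := {x | IsConj c x ∧ FreeGroup.norm x = k + 2 * m}
  set P := hAfin.toFinset.sigma fun g => (hBfin g m).toFinset with hP
  have hPmem : ∀ q : (_ : FreeGroup (Fin p)) × FreeGroup (Fin p),
      q ∈ P ↔ q.1 ∈ A ∧ q.2 ∈ GammaM p q.1 m := by
    intro q
    simp [hP]
  let φ : (_ : FreeGroup (Fin p)) × FreeGroup (Fin p) → FreeGroup (Fin p) :=
    fun q => q.2⁻¹ * q.1 * q.2
  have hφ : Set.InjOn φ P := by
    rintro ⟨g, w⟩ h1 ⟨g', w'⟩ h2 h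
    obtain ⟨hg, hw⟩ := (hPmem _).1 h1
    obtain ⟨hg', hw'⟩ := (hPmem _).1 h2
    have h := congr_arg FreeGroup.toWord h
    simp only [φ] at h hg hw hg' hw'
    rw [toWord_conj_of_mem_GammaM (hA1 g hg) hw, toWord_conj_of_mem_GammaM (hA1 g' hg') hw'] at h
    have hlen : w.toWord.length = w'.toWord.length := hw.1.trans hw'.1.symm
    obtain ⟨h3, h4⟩ := List.append_inj' h hlen
    obtain ⟨-, h5⟩ := List.append_inj h3 (by simpa using hlen)
    rw [FreeGroup.toWord_injective h4, FreeGroup.toWord_injective h5]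
  have himage : X = ↑(P.image φ) := by
    ext x
    simp only [Finset.coe_image, Set.mem_image, Finset.mem_coe, hPmem]
    constructor
    · rintro ⟨hx, hxn⟩
      obtain ⟨g, w, hg, hw, rfl⟩ := exists_eq_conj hc hk hx hxn
      exact ⟨⟨g, w⟩, ⟨hg, hw⟩, rfl⟩
    · rintro ⟨⟨g, w⟩, ⟨hg, hw⟩, rfl⟩
      refine ⟨hg.1.trans (isConj_iff.2 ⟨w⁻¹, by simp [φ]⟩), ?_⟩
      rw [FreeGroup.norm, toWord_conj_of_mem_GammaM (hA1 g hg) hw]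
      have h1 : w.toWord.length = m := hw.1
      have h2 : g.toWord.length = k := hg.2
      simp only [List.length_append, FreeGroup.invRev_length, h1, h2]
      ring
  have hcard : X.ncard = P.card := by
    rw [himage, Set.ncard_coe_finset, Finset.card_image_of_injOn hφ]
  rw [hcard, himage, finsum_mem_coe_finset, Finset.sum_image hφ,
    finsum_mem_eq_finite_toFinset_sum _ hAfin]
  simp_rw [finsum_mem_eq_finite_toFinset_sum _ (hBfin _ m), Finset.mul_sum]
  rw [Finset.sum_sigma']
  refine norm_sum_div_card_sub_le P _ _ (by positivity) ?_
  rintro ⟨g, w⟩ hq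
  obtain ⟨hg, hw⟩ := (hPmem _).1 hq
  have hF := abs_Ff_conj_sub_le hθ0 hθ1 hf hsymm (hA1 g hg) hw
  rw [hg.2] at hF
  set s := Real.sqrt (k + 2 * m)
  have hs : 0 ≤ s := Real.sqrt_nonneg _
  set a := birk p f k (seqOf p g.toWord)
  set b := birk p f m (seqOf p w.toWord)
  have key := norm_exp_I_mul_sub_le (t * Ff p f (w⁻¹ * g * w) / s) (t * (a + 2 * b) / s)
  rw [← Complex.exp_add]
  have e1 : Complex.I * t * (Ff p f (w⁻¹ * g * w)) / s =
      Complex.I * ((t * Ff p f (w⁻¹ * g * w) / s : ℝ) : ℂ) := by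
    push_cast
    ring
  have e2 : 2 * Complex.I * t / s * a / 2 + 2 * Complex.I * t / s * b =
      Complex.I * ((t * (a + 2 * b) / s : ℝ) : ℂ) := by
    push_cast
    ring
  simp only [φ]
  rw [e1, e2]
  refine key.trans ?_
  rw [← sub_div, ← mul_sub, abs_div, abs_mul, abs_of_nonneg hs]
  gcongr
  exact mul_le_mul_of_nonneg_left hF (abs_nonneg t)
end
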